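/- Let A be a unital C*-algebra, n a positive integer, and h a positive invertible element of M_n(A). Then for every X ∈ Aⁿ, (1/‖√h‖_{M_n(A)})·N_h(X) ≤ ‖X‖_st ≤ ‖√(h⁻¹)‖_{M_n(A)}·N_h(X), where ‖X‖_st = ‖∑_{j=1}^n X_j (X_j)*‖^{1/2} is the standard Hilbert-module norm on Aⁿ. -/

import Mathlib

open Matrix

/-- The `g`-inner product `⟨X|Y⟩_g = ∑_{j,k} X_j g_{jk} (Y_k)*` on `Aⁿ`,
for a matrix `g` with entries in a C*-algebra `A`. -/
noncomputable def gInner {A : Type*} [CStarAlgebra A] {n : ℕ}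
    (g : Matrix (Fin n) (Fin n) A) (X Y : Fin n → A) : A :=
  ∑ j, ∑ k, X j * g j k * star (Y k)

/-- The `g`-norm `N_g(X) = ‖⟨X|X⟩_g‖^{1/2}` on `Aⁿ`. -/
noncomputable def gNorm {A : Type*} [CStarAlgebra A] {n : ℕ}
    (g : Matrix (Fin n) (Fin n) A) (X : Fin n → A) : ℝ :=
  Real.sqrt ‖gInner g X X‖

/-- The standard norm `‖X‖_st = ‖∑_j X_j (X_j)*‖^{1/2}` on `Aⁿ`. -/
noncomputable def stNorm {A : Type*} [CStarAlgebra A] {n : ℕ}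
    (X : Fin n → A) : ℝ :=
  Real.sqrt ‖∑ j, X j * star (X j)‖

/-- The (unique) C*-norm of a matrix `m ∈ Mₙ(A)`, realized as the operator norm
of the right-multiplication action `X ↦ X·m` on the standard Hilbert
`A`-module `Aⁿ`. -/
noncomputable def matNorm {A : Type*} [CStarAlgebra A] {n : ℕ}
    (m : Matrix (Fin n) (Fin n) A) : ℝ :=
  sInf {c : ℝ | 0 ≤ c ∧ ∀ X : Fin n → A, stNorm (X ᵥ* m) ≤ c * stNorm X}

/-- The standard norm on `Aⁿ` is the Hilbert-module norm of Mathlib, so right multiplication by a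
matrix is bounded. -/
lemma exists_stNorm_vecMul_le {A : Type*} [CStarAlgebra A] {n : ℕ}
    (m : Matrix (Fin n) (Fin n) A) :
    ∃ c : ℝ, 0 ≤ c ∧ ∀ X : Fin n → A, stNorm (X ᵥ* m) ≤ c * stNorm X := by
  let : PartialOrder A := CStarAlgebra.spectralOrder A
  have : StarOrderedRing A := CStarAlgebra.spectralOrderedRing A
  have key (X : Fin n → A) :
      ‖(WithCStarModule.equiv A (Fin n → A)).symm X‖ = stNorm X := by
    rw [WithCStarModule.pi_norm]
    rfl
  refine ⟨‖CStarMatrix.toCLM (CStarMatrix.ofMatrix m)‖, ContinuousLinearMap.opNorm_nonneg _, fun X ↦ ?_⟩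
  rw [← key, ← key]
  exact (CStarMatrix.toCLM (CStarMatrix.ofMatrix m)).le_opNorm _

lemma matNorm_nonneg {A : Type*} [CStarAlgebra A] {n : ℕ} (m : Matrix (Fin n) (Fin n) A) :
    0 ≤ matNorm m :=
  Real.sInf_nonneg fun _ hc ↦ hc.1

lemma stNorm_vecMul_le {A : Type*} [CStarAlgebra A] {n : ℕ}
    (m : Matrix (Fin n) (Fin n) A) (X : Fin n → A) :
    stNorm (X ᵥ* m) ≤ matNorm m * stNorm X := by
  obtain ⟨c₀, hc₀, hb⟩ := exists_stNorm_vecMul_le m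
  have hX : 0 ≤ stNorm X := Real.sqrt_nonneg _
  rcases hX.eq_or_lt with h0 | hpos
  · simpa [← h0] using hb X
  · rw [← div_le_iff₀ hpos]
    exact le_csInf ⟨c₀, hc₀, hb⟩ fun c hc ↦ (div_le_iff₀ hpos).2 (hc.2 X)

lemma gInner_eq_dotProduct {A : Type*} [CStarAlgebra A] {n : ℕ}
    (g : Matrix (Fin n) (Fin n) A) (X Y : Fin n → A) :
    gInner g X Y = X ᵥ* g ⬝ᵥ star Y := by
  simp only [gInner, dotProduct, vecMul, Pi.star_apply, Finset.sum_mul]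
  exact Finset.sum_comm

lemma stNorm_eq_gNorm_one {A : Type*} [CStarAlgebra A] {n : ℕ} (X : Fin n → A) :
    stNorm X = gNorm 1 X := by
  rw [gNorm, gInner_eq_dotProduct, vecMul_one]
  rfl

/-- The standard norm of `X·m` is the norm of `X` with respect to `m m*`. -/
lemma stNorm_vecMul {A : Type*} [CStarAlgebra A] {n : ℕ}
    (m : Matrix (Fin n) (Fin n) A) (X : Fin n → A) :
    stNorm (X ᵥ* m) = gNorm (m * mᴴ) X := by
  rw [stNorm_eq_gNorm_one, gNorm, gNorm, gInner_eq_dotProduct, gInner_eq_dotProduct, vecMul_one,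
    star_vecMul, dotProduct_mulVec, vecMul_vecMul]

/-- For a positive invertible matrix `h ∈ Mₙ(A)` with inverse `hi = h⁻¹` and
positive square roots `sh = √h`, `shi = √(h⁻¹)`, one has
`(1/‖√h‖) N_h(X) ≤ ‖X‖_st ≤ ‖√(h⁻¹)‖ N_h(X)` for all `X ∈ Aⁿ`. -/
theorem stNorm_le_gNorm {A : Type*} [CStarAlgebra A]
    {n : ℕ} (hn : 0 < n)
    (h hi sh shi : Matrix (Fin n) (Fin n) A)
    (hh : ∃ m : Matrix (Fin n) (Fin n) A, h = mᴴ * m)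
    (hhi : h * hi = 1 ∧ hi * h = 1)
    (hsh : (∃ m : Matrix (Fin n) (Fin n) A, sh = mᴴ * m) ∧ sh * sh = h)
    (hshi : (∃ m : Matrix (Fin n) (Fin n) A, shi = mᴴ * m) ∧ shi * shi = hi)
    (X : Fin n → A) :
    (1 / matNorm sh) * gNorm h X ≤ stNorm X ∧
      stNorm X ≤ matNorm shi * gNorm h X := by
  obtain ⟨⟨a, ha⟩, rfl⟩ := hsh
  obtain ⟨⟨b, hb⟩, rfl⟩ := hshi
  have hsh_adj : shᴴ = sh := by simp [ha]
  have hshi_adj : shiᴴ = shi := by simp [hb]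
  have hg : gNorm (sh * sh) X = stNorm (X ᵥ* sh) := by rw [stNorm_vecMul, hsh_adj]
  have hcomm : Commute sh (shi * shi) :=
    calc sh * (shi * shi) = (shi * shi) * (sh * sh) * (sh * (shi * shi)) := by rw [hhi.2, one_mul]
      _ = (shi * shi) * sh * ((sh * sh) * (shi * shi)) := by simp only [mul_assoc]
      _ = (shi * shi) * sh := by rw [hhi.1, mul_one]
  have hunit : sh * shi * (sh * shi)ᴴ = 1 :=
    calc sh * shi * (sh * shi)ᴴ = sh * ((shi * shi) * sh) := by
          rw [conjTranspose_mul, hsh_adj, hshi_adj]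
          simp only [mul_assoc]
      _ = 1 := by rw [← hcomm.eq, ← mul_assoc, hhi.1]
  have hX : stNorm (X ᵥ* sh ᵥ* shi) = stNorm X := by
    rw [vecMul_vecMul, stNorm_vecMul, hunit, stNorm_eq_gNorm_one]
  rw [hg]
  constructor
  · rw [one_div, inv_mul_eq_div]
    refine div_le_of_le_mul₀ (matNorm_nonneg _) (Real.sqrt_nonneg _) ?_
    rw [mul_comm]
    exact stNorm_vecMul_le sh X
  · rw [← hX]
    exact stNorm_vecMul_le shi (X ᵥ* sh)
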